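/- arXiv:2307.00346 — 3 statements merged into one kernel-verified Lean document; each statement's English description precedes it below -/
import Mathlib

section
/- Let s, n, k, r be positive integers, let m₁,…,m_k range over integers in [1, n^s] and b₁,…,b_r range over integers in [1, n^s], and let a₁,…,a_k be integers with (aᵢ, n^s)_s = 1 for each i. Then the sum over all tuples (m₁,…,m_k, b₁,…,b_r) with (mᵢ, n^s)_s = 1 for each i, of (m₁ − a₁, m₂ − a₂, …, m_k − a_k, b₁, …, b_r, n^s)_s, equals Φ_s(n^s)^k · Σ_{d : d^s | n^s} (d^s)^r / Φ_s(n^s/d^s)^{k−1}. -/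
open scoped Classical

/-- The generalized gcd `(a, b)_s`: the largest positive integer of the form `l ^ s`
(`l ∈ ℕ`) dividing both `a` and `b`. -/
noncomputable def sgcd (s : ℕ) (a b : ℤ) : ℕ :=
  sSup {m : ℕ | 0 < m ∧ (∃ l : ℕ, m = l ^ s) ∧ (m : ℤ) ∣ a ∧ (m : ℤ) ∣ b}

/-- Klee's function `Φ_s(n)`: the number of `m` with `1 ≤ m ≤ n` and `(m, n)_s = 1`. -/
noncomputable def klee (s n : ℕ) : ℕ :=
  ((Finset.Icc 1 n).filter (fun m => sgcd s (m : ℤ) (n : ℤ) = 1)).card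
/-- The generalized gcd of a list of integers: the largest positive integer of the
form `l ^ s` (`l ∈ ℕ`) dividing every member of the list. -/
noncomputable def sgcdList (s : ℕ) (L : List ℤ) : ℕ :=
  sSup {m : ℕ | 0 < m ∧ (∃ l : ℕ, m = l ^ s) ∧ ∀ a ∈ L, (m : ℤ) ∣ a}

/-- `x` is `s`-coprime to `n ^ s`: no `l > 1` dividing `n` satisfies `l ^ s ∣ x`. -/
def PowCoprime (s n : ℕ) (x : ℤ) : Prop :=
  ∀ l : ℕ, l ∣ n → (l : ℤ) ^ s ∣ x → l = 1

theorem PowCoprime.of_dvd {s n d : ℕ} {x : ℤ} (h : PowCoprime s n x) (hd : d ∣ n) :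
    PowCoprime s d x :=
  fun l hl hx => h l (hl.trans hd) hx

theorem powCoprime_of_prime {s n : ℕ} {x : ℤ}
    (h : ∀ p : ℕ, p.Prime → p ∣ n → ¬ (p : ℤ) ^ s ∣ x) : PowCoprime s n x := by
  intro l hl hx
  by_contra hne
  obtain ⟨p, hp, hpl⟩ := Nat.exists_prime_and_dvd hne
  exact h p hp (hpl.trans hl)
    ((pow_dvd_pow_of_dvd (Int.natCast_dvd_natCast.2 hpl) s).trans hx)

theorem PowCoprime.congr {s n : ℕ} {x y : ℤ} (h : PowCoprime s n x)
    (hxy : (n : ℤ) ^ s ∣ y - x) : PowCoprime s n y := by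
  intro l hl hy
  refine h l hl ?_
  have := (pow_dvd_pow_of_dvd (Int.natCast_dvd_natCast.2 hl) s).trans hxy
  exact (dvd_sub_right hy).1 this

/-- The `l ∣ n` whose `s`-th power divides all members of `L` are the divisors of one number. -/
theorem exists_max_pow_dvd (s n : ℕ) (hn : 0 < n) (L : List ℤ) :
    ∃ g : ℕ, g ∣ n ∧ ∀ l : ℕ, l ∣ g ↔ l ∣ n ∧ ∀ a ∈ L, (l : ℤ) ^ s ∣ a := by
  set S := n.divisors.filter (fun l : ℕ => ∀ a ∈ L, (l : ℤ) ^ s ∣ a) with hS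
  have key : ∀ T ⊆ S, ∀ a ∈ L, ((T.lcm id : ℕ) : ℤ) ^ s ∣ a := by
    intro T
    induction T using Finset.induction_on with
    | empty => intro _ a _; simp
    | insert l T _ ih =>
      intro hT a ha
      have h1 := ih ((Finset.subset_insert _ _).trans hT) a ha
      have h2 := (Finset.mem_filter.1 (hT (Finset.mem_insert_self l T))).2 a ha
      rw [Finset.lcm_insert]
      rw [← Int.natCast_pow, Int.natCast_dvd] at h1 h2 ⊢
      simp only [id, lcm_eq_nat_lcm] at h1 h2 ⊢
      rw [← Nat.pow_lcm_pow]
      exact Nat.lcm_dvd h2 h1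
  have hgn : S.lcm id ∣ n :=
    Finset.lcm_dvd fun l hl => Nat.dvd_of_mem_divisors (Finset.mem_filter.1 hl).1
  refine ⟨S.lcm id, hgn, fun l => ⟨fun hl => ⟨hl.trans hgn, fun a ha => ?_⟩, fun hl => ?_⟩⟩
  · exact (pow_dvd_pow_of_dvd (Int.natCast_dvd_natCast.2 hl) s).trans (key S subset_rfl a ha)
  · exact Finset.dvd_lcm (f := id)
      (Finset.mem_filter.2 ⟨Nat.mem_divisors.2 ⟨hl.1, hn.ne'⟩, hl.2⟩)

theorem sgcdList_eq_pow {s n g : ℕ} (hs : 0 < s) (hg0 : 0 < g) {L : List ℤ}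
    (hg : ∀ l : ℕ, l ∣ g ↔ l ∣ n ∧ ∀ a ∈ L, (l : ℤ) ^ s ∣ a) :
    sgcdList s (L ++ [(n : ℤ) ^ s]) = g ^ s := by
  have hmem : ∀ l : ℕ, (∀ a ∈ L ++ [(n : ℤ) ^ s], ((l ^ s : ℕ) : ℤ) ∣ a) ↔ l ∣ g := by
    intro l
    have : ((l : ℤ) ^ s ∣ (n : ℤ) ^ s) ↔ l ∣ n := by
      exact_mod_cast Nat.pow_dvd_pow_iff hs.ne'
    rw [hg, ← this]
    simp only [List.mem_append, List.mem_singleton, Nat.cast_pow]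
    constructor
    · exact fun h => ⟨h _ (Or.inr rfl), fun a ha => h a (Or.inl ha)⟩
    · rintro ⟨h1, h2⟩ a (ha | rfl)
      exacts [h2 a ha, h1]
  refine IsGreatest.csSup_eq ⟨⟨by positivity, ⟨g, rfl⟩, (hmem g).2 dvd_rfl⟩, ?_⟩
  rintro _ ⟨_, ⟨l, rfl⟩, h⟩
  exact Nat.pow_le_pow_left (Nat.le_of_dvd hg0 ((hmem l).1 h)) s

theorem sgcd_eq_one_iff {s n : ℕ} (hs : 0 < s) (hn : 0 < n) (x : ℤ) :
    sgcd s x ((n : ℤ) ^ s) = 1 ↔ PowCoprime s n x := by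
  obtain ⟨g, hgn, hg⟩ := exists_max_pow_dvd s n hn [x]
  have h1 : sgcd s x ((n : ℤ) ^ s) = g ^ s := by
    rw [← sgcdList_eq_pow hs (Nat.pos_of_dvd_of_pos hgn hn) hg]
    simp [sgcd, sgcdList]
  rw [h1, Nat.pow_eq_one, or_iff_left hs.ne']
  simp only [List.mem_singleton, forall_eq] at hg
  constructor
  · rintro rfl l hl hx
    exact Nat.dvd_one.1 ((hg l).2 ⟨hl, hx⟩)
  · exact fun h => h g hgn ((hg g).1 dvd_rfl).2

theorem finset_bind_pure_natCast (S : Finset ℕ) :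
    (S >>= fun x => pure (x : ℤ)) = S.image (Nat.cast : ℕ → ℤ) := by
  ext x
  simp [Finset.bind_def, eq_comm]

theorem card_filter_image_natCast (S : Finset ℕ) (p : ℤ → Prop) [DecidablePred p] :
    ((S.image (Nat.cast : ℕ → ℤ)).filter p).card = (S.filter fun x : ℕ => p x).card := by
  rw [Finset.filter_image, Finset.card_image_of_injective _ Nat.cast_injective]

theorem klee_pow_eq {s n : ℕ} (hs : 0 < s) (hn : 0 < n) :
    klee s (n ^ s) = ((Finset.Icc 1 (n ^ s)).filter fun x : ℕ => PowCoprime s n x).card := by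
  simp only [klee, Nat.cast_pow, sgcd_eq_one_iff hs hn, finset_bind_pure_natCast,
    card_filter_image_natCast]

theorem klee_pow_pos {s n : ℕ} (hs : 0 < s) (hn : 0 < n) : 0 < klee s (n ^ s) := by
  rw [klee_pow_eq hs hn, Finset.card_pos]
  refine ⟨1, Finset.mem_filter.2 ⟨Finset.mem_Icc.2 ⟨le_rfl, Nat.pow_pos hn⟩, ?_⟩⟩
  intro l _ h
  have h' : l ^ s ∣ 1 := by exact_mod_cast h
  simpa [hs.ne'] using h'

theorem sum_divisors_klee_pow {s g : ℕ} (hs : 0 < s) (hg : 0 < g) :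
    ∑ d ∈ g.divisors, klee s (d ^ s) = g ^ s := by
  rw [← Nat.sum_div_divisors g fun d => klee s (d ^ s)]
  choose f hfg hf using fun x : ℕ => exists_max_pow_dvd s g hg [(x : ℤ)]
  simp only [List.mem_singleton, forall_eq] at hf
  have hf' : ∀ x l : ℕ, l ∣ f x ↔ l ∣ g ∧ l ^ s ∣ x := by
    intro x l
    rw [hf]
    norm_cast
  have hcard := Finset.card_eq_sum_card_fiberwise (s := Finset.Icc 1 (g ^ s)) (t := g.divisors)
    (f := f) fun x _ => Nat.mem_divisors.2 ⟨hfg x, hg.ne'⟩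
  rw [Nat.card_Icc, Nat.add_sub_cancel] at hcard
  rw [hcard]
  refine Finset.sum_congr rfl fun h hh => ?_
  obtain ⟨d, rfl⟩ := Nat.dvd_of_mem_divisors hh
  have h0 : 0 < h := Nat.pos_of_mul_pos_right hg
  have d0 : 0 < d := Nat.pos_of_mul_pos_left hg
  rw [Nat.mul_div_cancel_left _ h0, klee_pow_eq hs d0]
  refine Finset.card_bij (fun y _ => h ^ s * y) ?_ ?_ ?_
  · intro y hy
    simp only [Finset.mem_filter, Finset.mem_Icc] at hy ⊢
    obtain ⟨⟨hy1, hy2⟩, hy⟩ := hy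
    refine ⟨⟨Nat.mul_pos (Nat.pow_pos h0) hy1, ?_⟩, ?_⟩
    · rw [mul_pow]
      exact Nat.mul_le_mul_left _ hy2
    · obtain ⟨c, hc⟩ := (hf' (h ^ s * y) h).2 ⟨dvd_mul_right _ _, dvd_mul_right _ _⟩
      have := (hf' (h ^ s * y) (h * c)).1 (hc ▸ dvd_rfl)
      rw [mul_pow, Nat.mul_dvd_mul_iff_left h0, Nat.mul_dvd_mul_iff_left (Nat.pow_pos h0)] at this
      have hc1 := hy c this.1 (by exact_mod_cast this.2)
      rw [hc, hc1, mul_one]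
  · intro y _ y' _ hyy
    exact Nat.eq_of_mul_eq_mul_left (Nat.pow_pos h0) hyy
  · intro x hx
    simp only [Finset.mem_filter, Finset.mem_Icc] at hx
    obtain ⟨⟨hx1, hx2⟩, hx⟩ := hx
    obtain ⟨y, rfl⟩ := ((hf' x h).1 (hx ▸ dvd_rfl)).2
    refine ⟨y, ?_, rfl⟩
    rw [mul_pow] at hx2
    simp only [Finset.mem_filter, Finset.mem_Icc]
    refine ⟨⟨Nat.pos_of_mul_pos_left hx1, Nat.le_of_mul_le_mul_left hx2 (Nat.pow_pos h0)⟩, ?_⟩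
    intro c hc hcy
    have hcy' : c ^ s ∣ y := by exact_mod_cast hcy
    have := (hf' (h ^ s * y) (h * c)).2
      ⟨Nat.mul_dvd_mul_left h hc, by rw [mul_pow]; exact Nat.mul_dvd_mul_left _ hcy'⟩
    rw [hx] at this
    exact Nat.dvd_one.1 ((Nat.mul_dvd_mul_iff_left h0).1 (by simpa using this))

theorem card_filter_Icc_add_of_periodic {p : ℕ → Prop} [DecidablePred p] {N : ℕ}
    (hp : Function.Periodic p N) (t : ℕ) :
    ((Finset.Icc 1 N).filter fun x => p (x + t)).card = ((Finset.Icc 1 N).filter p).card := by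
  have hI : ∀ (q : ℕ → Prop) [DecidablePred q], Function.Periodic q N →
      ((Finset.Icc 1 N).filter q).card = N.count q := by
    intro q _ hq
    rw [← Nat.filter_Ico_card_eq_of_periodic 1 N q hq]
    congr 2
    ext x
    simp only [Finset.mem_Icc, Finset.mem_Ico]
    omega
  rw [hI p hp, ← Nat.filter_Ico_card_eq_of_periodic (1 + t) N p hp]
  refine Finset.card_bij (fun x _ => x + t) ?_ (fun _ _ _ _ h => Nat.add_right_cancel h) ?_
  · intro x hx
    simp only [Finset.mem_filter, Finset.mem_Icc, Finset.mem_Ico] at hx ⊢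
    exact ⟨by omega, hx.2⟩
  · intro y hy
    simp only [Finset.mem_filter, Finset.mem_Ico] at hy
    refine ⟨y - t, ?_, by omega⟩
    simp only [Finset.mem_filter, Finset.mem_Icc]
    exact ⟨by omega, by rw [Nat.sub_add_cancel (by omega)]; exact hy.2⟩

/-- The number of `s`-coprime residues modulo `n ^ s` in the class of `a` modulo `d ^ s`. -/
noncomputable def fiberCard (s n d : ℕ) (a : ℤ) : ℕ :=
  ((Finset.Icc 1 (n ^ s)).filter fun x : ℕ =>
    PowCoprime s n x ∧ (d : ℤ) ^ s ∣ (x : ℤ) - a).card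

theorem PowCoprime.add_of_dvd {s n d e : ℕ} {x t b : ℤ} (h : PowCoprime s n x)
    (hb : PowCoprime s d b) (he : ∀ p : ℕ, p.Prime → p ∣ n → ¬ p ∣ d → p ∣ e)
    (het : (e : ℤ) ^ s ∣ t) (hd : (d : ℤ) ^ s ∣ x + t - b) : PowCoprime s n (x + t) := by
  refine powCoprime_of_prime fun p hp hpn hpx => ?_
  by_cases hpd : p ∣ d
  · have h1 := (pow_dvd_pow_of_dvd (Int.natCast_dvd_natCast.2 hpd) s).trans hd
    exact hp.one_lt.ne' (hb p hpd ((dvd_sub_right hpx).1 h1))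
  · have h1 := (pow_dvd_pow_of_dvd (Int.natCast_dvd_natCast.2 (he p hp hpn hpd)) s).trans het
    exact hp.one_lt.ne' (h p hpn ((dvd_add_left h1).1 hpx))

theorem fiberCard_congr {s n d : ℕ} (hn : 0 < n) (hd : d ∣ n) {a b : ℤ}
    (ha : PowCoprime s d a) (hb : PowCoprime s d b) : fiberCard s n d a = fiberCard s n d b := by
  have hd0 : 0 < d := Nat.pos_of_dvd_of_pos hd hn
  set e := ∏ p ∈ n.primeFactors.filter (fun p => ¬ p ∣ d), p with he
  have hpe : ∀ p : ℕ, p.Prime → p ∣ n → ¬ p ∣ d → p ∣ e := fun p hp hpn hpd =>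
    Finset.dvd_prod_of_mem _
      (Finset.mem_filter.2 ⟨Nat.mem_primeFactors.2 ⟨hp, hpn, hn.ne'⟩, hpd⟩)
  have hco : Nat.Coprime (e ^ s) (d ^ s) := by
    refine Nat.Coprime.pow _ _ (Nat.Coprime.prod_left fun p hp => ?_)
    rw [Finset.mem_filter] at hp
    exact (Nat.Prime.coprime_iff_not_dvd (Nat.prime_of_mem_primeFactors hp.1)).2 hp.2
  have hds : (0 : ℤ) < (d : ℤ) ^ s := by positivity
  obtain ⟨t, ht0, ht1⟩ := Nat.chineseRemainder hco 0 ((b - a) % (d : ℤ) ^ s).toNat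
  have het : (e : ℤ) ^ s ∣ (t : ℤ) := by
    exact_mod_cast (Nat.modEq_zero_iff_dvd.1 ht0)
  have hdt : (d : ℤ) ^ s ∣ (b - a) - t := by
    have h1 := (Nat.modEq_iff_dvd.1 ht1)
    rw [Int.toNat_of_nonneg (Int.emod_nonneg _ hds.ne')] at h1
    push_cast at h1
    have h2 : (d : ℤ) ^ s ∣ (b - a) - (b - a) % (d : ℤ) ^ s := Int.dvd_self_sub_emod
    have := dvd_add h1 h2
    ring_nf at this ⊢
    exact this
  have hper : Function.Periodic
      (fun x : ℕ => PowCoprime s n x ∧ (d : ℤ) ^ s ∣ (x : ℤ) - b) (n ^ s) := by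
    intro x
    have h1 : (d : ℤ) ^ s ∣ (n : ℤ) ^ s := pow_dvd_pow_of_dvd (Int.natCast_dvd_natCast.2 hd) s
    apply propext
    push_cast
    refine and_congr ⟨fun h => h.congr ?_, fun h => h.congr ?_⟩ ?_
    · exact ⟨-1, by ring⟩
    · exact ⟨1, by ring⟩
    · rw [add_sub_right_comm, dvd_add_left h1]
  rw [fiberCard, fiberCard]
  refine Eq.trans ?_ (card_filter_Icc_add_of_periodic hper t)
  congr 1
  refine Finset.filter_congr fun x _ => ?_
  push_cast
  have hiff : (d : ℤ) ^ s ∣ (x : ℤ) - a ↔ (d : ℤ) ^ s ∣ (x : ℤ) + t - b := by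
    rw [show (x : ℤ) + t - b = (x - a) - (b - a - t) by ring, dvd_sub_left hdt]
  rw [hiff]
  refine and_congr_left fun hx => ⟨fun h => h.add_of_dvd hb hpe het hx, fun h => ?_⟩
  have := h.add_of_dvd (t := -(t : ℤ)) ha hpe ((dvd_neg).2 het) (by
    rw [add_neg_cancel_right]
    exact hiff.2 hx)
  rwa [add_neg_cancel_right] at this

theorem fiberCard_mul_klee {s n d : ℕ} (hs : 0 < s) (hn : 0 < n) (hd : d ∣ n) {a : ℤ}
    (ha : PowCoprime s d a) : fiberCard s n d a * klee s (d ^ s) = klee s (n ^ s) := by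
  have hd0 : 0 < d := Nat.pos_of_dvd_of_pos hd hn
  have hD : 0 < d ^ s := Nat.pow_pos hd0
  set f : ℕ → ℕ := fun x => if x % d ^ s = 0 then d ^ s else x % d ^ s with hf
  have hfmem : ∀ x, f x ∈ Finset.Icc 1 (d ^ s) := by
    intro x
    have := Nat.mod_lt x hD
    simp only [hf, Finset.mem_Icc]
    generalize x % d ^ s = y at *
    split_ifs <;> omega
  have hfmod : ∀ x, f x ≡ x [MOD d ^ s] := by
    intro x
    simp only [hf]
    split_ifs with h
    · simp [Nat.ModEq, h]
    · exact Nat.mod_modEq _ _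
  have hfdvd : ∀ x : ℕ, (d : ℤ) ^ s ∣ (x : ℤ) - f x := by
    intro x
    exact_mod_cast Nat.modEq_iff_dvd.1 (hfmod x)
  rw [klee_pow_eq hs hn, klee_pow_eq hs hd0, Finset.card_eq_sum_card_fiberwise (f := f)
      (s := (Finset.Icc 1 (n ^ s)).filter fun x : ℕ => PowCoprime s n x)
      (t := (Finset.Icc 1 (d ^ s)).filter fun x : ℕ => PowCoprime s d x)]
  · rw [mul_comm, ← smul_eq_mul, ← Finset.sum_const]
    refine Finset.sum_congr rfl fun c hc => ?_
    rw [Finset.mem_filter, Finset.mem_Icc] at hc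
    rw [fiberCard_congr hn hd ha hc.2, fiberCard, Finset.filter_filter]
    congr 1
    refine Finset.filter_congr fun x _ => and_congr_right fun _ => ?_
    constructor
    · intro h
      have h1 : f x ≡ c [MOD d ^ s] := by
        refine (hfmod x).trans (Nat.modEq_iff_dvd.2 ?_)
        rw [← dvd_neg]
        push_cast
        rwa [neg_sub]
      have h2 := Finset.mem_Icc.1 (hfmem x)
      have h3 := (Nat.modEq_iff_dvd.1 h1)
      have h4 := Int.eq_zero_of_abs_lt_dvd h3 (by rw [abs_lt]; omega)
      omega
    · rintro rfl
      exact hfdvd x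
  · intro x hx
    simp only [Finset.coe_filter, Set.mem_ofPred_eq] at hx ⊢
    refine ⟨hfmem x, (hx.2.of_dvd hd).congr ?_⟩
    rw [← dvd_neg, neg_sub]
    exact hfdvd x

theorem card_filter_Icc_dvd {s n d : ℕ} :
    ((Finset.Icc 1 (n ^ s)).filter fun x : ℕ => (d : ℤ) ^ s ∣ (x : ℤ)).card
      = n ^ s / d ^ s := by
  rw [← Nat.Ioc_filter_dvd_card_eq_div]
  congr 1
  ext x
  simp only [Finset.mem_filter, Finset.mem_Icc, Finset.mem_Ioc]
  norm_cast

theorem sgcdList_eq_sum {s n : ℕ} (hs : 0 < s) (hn : 0 < n) (L : List ℤ) :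
    sgcdList s (L ++ [(n : ℤ) ^ s])
      = ∑ d ∈ n.divisors, if ∀ a ∈ L, (d : ℤ) ^ s ∣ a then klee s (d ^ s) else 0 := by
  obtain ⟨g, hgn, hg⟩ := exists_max_pow_dvd s n hn L
  have hg0 := Nat.pos_of_dvd_of_pos hgn hn
  rw [sgcdList_eq_pow hs hg0 hg, ← sum_divisors_klee_pow hs hg0, ← Finset.sum_filter]
  refine Finset.sum_congr ?_ fun _ _ => rfl
  ext d
  simp [hg, hg0.ne', hn.ne']

theorem card_filter_piFinset_const {ι α : Type*} [Fintype ι] [DecidableEq ι] (S : Finset α)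
    (p : ι → α → Prop) [∀ i, DecidablePred (p i)] :
    ((Fintype.piFinset fun _ : ι => S).filter fun m => ∀ i, p i (m i)).card
      = ∏ i, (S.filter (p i)).card := by
  rw [← Fintype.card_piFinset]
  congr 1
  ext m
  simp [forall_and]

theorem menon_type_identity_general (s n k r : ℕ) (hs : 0 < s) (hn : 0 < n)
    (hk : 0 < k) (hr : 0 < r) (a : Fin k → ℤ)
    (ha : ∀ i, sgcd s (a i) ((n : ℤ) ^ s) = 1) :
    ∑ m ∈ Fintype.piFinset (fun _ : Fin k =>
        (Finset.Icc 1 (n ^ s)).filter (fun x => sgcd s (x : ℤ) ((n : ℤ) ^ s) = 1)),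
      ∑ b ∈ Fintype.piFinset (fun _ : Fin r => Finset.Icc 1 (n ^ s)),
        (sgcdList s (List.ofFn (fun i => (m i : ℤ) - a i) ++
          List.ofFn (fun i : Fin r => (b i : ℤ)) ++ [(n : ℤ) ^ s]) : ℚ)
    = (klee s (n ^ s) : ℚ) ^ k *
      ∑ d ∈ (n ^ s).divisors.filter (fun d => d ^ s ∣ n ^ s),
        ((d : ℚ) ^ s) ^ r / (klee s (n ^ s / d ^ s) : ℚ) ^ (k - 1) := by
  simp only [sgcd_eq_one_iff hs hn, finset_bind_pure_natCast] at ha ⊢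
  have hcount : ∀ d ∈ n.divisors,
      ∑ m ∈ Fintype.piFinset (fun _ : Fin k =>
        ((Finset.Icc 1 (n ^ s)).image (Nat.cast : ℕ → ℤ)).filter (PowCoprime s n)),
      ∑ b ∈ Fintype.piFinset (fun _ : Fin r => Finset.Icc 1 (n ^ s)),
        (if ∀ c ∈ List.ofFn (fun i => m i - a i) ++ List.ofFn (fun i : Fin r => (b i : ℤ)),
          (d : ℤ) ^ s ∣ c then klee s (d ^ s) else 0)
      = (∏ i, fiberCard s n d (a i)) * (n ^ s / d ^ s) ^ r * klee s (d ^ s) := by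
    intro d _
    have hsplit : ∀ (m : Fin k → ℤ) (b : Fin r → ℕ),
        (∀ c ∈ List.ofFn (fun i => m i - a i) ++ List.ofFn (fun i : Fin r => (b i : ℤ)),
          (d : ℤ) ^ s ∣ c) ↔
        (∀ i, (d : ℤ) ^ s ∣ m i - a i) ∧ ∀ i, (d : ℤ) ^ s ∣ (b i : ℤ) := by
      intro m b
      simp only [List.mem_append, List.mem_ofFn, or_imp, forall_and, forall_exists_index,
        forall_apply_eq_imp_iff]
    simp only [hsplit]
    have hm := card_filter_piFinset_const
      (((Finset.Icc 1 (n ^ s)).image (Nat.cast : ℕ → ℤ)).filter (PowCoprime s n))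
      (fun (i : Fin k) (x : ℤ) => (d : ℤ) ^ s ∣ x - a i)
    have hb := card_filter_piFinset_const (Finset.Icc 1 (n ^ s))
      (fun (_ : Fin r) (x : ℕ) => (d : ℤ) ^ s ∣ (x : ℤ))
    simp only [card_filter_Icc_dvd, Finset.prod_const, Finset.card_univ, Fintype.card_fin] at hb
    simp only [Finset.filter_filter, card_filter_image_natCast] at hm
    change _ = ∏ i, fiberCard s n d (a i) at hm
    rw [← hm, ← hb, ← Finset.card_product, ← smul_eq_mul, ← Finset.sum_const,
      ← Finset.sum_product', ← Finset.sum_filter]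
    refine Finset.sum_congr ?_ fun _ _ => rfl
    ext x
    simp only [Finset.mem_filter, Finset.mem_product]
    exact and_and_and_comm
  have hnat := Finset.sum_congr rfl hcount
  simp only [sgcdList_eq_sum hs hn]
  have hcomm : ∀ (A : Finset (Fin k → ℤ)) (B : Finset (Fin r → ℕ)) (D : Finset ℕ)
      (F : (Fin k → ℤ) → (Fin r → ℕ) → ℕ → ℕ),
      ∑ m ∈ A, ∑ b ∈ B, ∑ d ∈ D, F m b d = ∑ d ∈ D, ∑ m ∈ A, ∑ b ∈ B, F m b d := by
    intro A B D F
    rw [Finset.sum_comm]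
    simp_rw [Finset.sum_comm (s := A) (t := D), Finset.sum_comm (s := B) (t := D)]
    refine Finset.sum_congr rfl fun d _ => Finset.sum_comm
  have hcast := congrArg (Nat.cast : ℕ → ℚ) ((hcomm _ _ _ _).trans hnat)
  rw [Nat.cast_sum] at hcast
  simp only [Nat.cast_sum (s := Fintype.piFinset _)] at hcast
  rw [hcast]
  have hdiv : (n ^ s).divisors.filter (fun d => d ^ s ∣ n ^ s) = n.divisors := by
    ext d
    simp only [Finset.mem_filter, Nat.mem_divisors, Nat.pow_dvd_pow_iff hs.ne']
    exact ⟨fun h => ⟨h.2, hn.ne'⟩,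
      fun h => ⟨⟨h.1.trans (dvd_pow_self n hs.ne'), (Nat.pow_pos hn).ne'⟩, h.1⟩⟩
  rw [hdiv, Finset.mul_sum, Nat.cast_sum, ← Nat.sum_div_divisors]
  refine Finset.sum_congr rfl fun d hd => ?_
  obtain ⟨e, rfl⟩ := Nat.dvd_of_mem_divisors hd
  have d0 : 0 < d := Nat.pos_of_mul_pos_right hn
  have e0 : 0 < e := Nat.pos_of_mul_pos_left hn
  have hfib : ∀ i, (fiberCard s (d * e) e (a i) : ℚ)
      = klee s ((d * e) ^ s) / klee s (e ^ s) := by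
    intro i
    rw [eq_div_iff (by exact_mod_cast (klee_pow_pos hs e0).ne')]
    exact_mod_cast fiberCard_mul_klee hs hn (dvd_mul_left e d) ((ha i).of_dvd (dvd_mul_left e d))
  have he : (klee s (e ^ s) : ℚ) ≠ 0 := by exact_mod_cast (klee_pow_pos hs e0).ne'
  have h1 : (d * e) ^ s / d ^ s = e ^ s := by
    rw [mul_pow, Nat.mul_div_cancel_left _ (Nat.pow_pos d0)]
  have h2 : (d * e) ^ s / e ^ s = d ^ s := by
    rw [mul_pow, Nat.mul_div_cancel _ (Nat.pow_pos e0)]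
  obtain ⟨j, rfl⟩ := Nat.exists_eq_add_of_le' hk
  rw [Nat.mul_div_cancel_left _ d0, h1, h2]
  push_cast
  simp only [hfib, Finset.prod_const, Finset.card_univ, Fintype.card_fin, div_pow]
  field_simp
  ring
end

section
/- Let ψ : ℕ² → ℂ be an arbitrary function and let n, s be positive integers. Then Σ_{k=1}^{n^s} ψ(k, n^s) · (k, n^s)_s = Σ_{d : d^s | n^s} Φ_s(d^s) · Σ_{j=1}^{n^s/d^s} ψ(d^s · j, n^s), where the outer sum on the right is over positive integers d with d^s dividing n^s. -/
open scoped Classical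

/-- The largest `l` (with respect to divisibility) such that `l ^ s ∣ c`. -/
def powRoot (s c : ℕ) : ℕ := (c.divisors.filter (fun l => l ^ s ∣ c)).lcm id

theorem powRoot_pow_dvd (s c : ℕ) : powRoot s c ^ s ∣ c := by
  suffices h : ∀ S : Finset ℕ, (∀ l ∈ S, l ^ s ∣ c) → (S.lcm id) ^ s ∣ c from
    h _ fun l hl => (Finset.mem_filter.mp hl).2
  intro S
  induction S using Finset.induction_on with
  | empty => simp
  | insert a S ha ih =>
    intro h
    rw [Finset.lcm_insert, id, lcm_eq_nat_lcm, ← Nat.pow_lcm_pow]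
    exact Nat.lcm_dvd (h a (Finset.mem_insert_self a S))
      (ih fun l hl => h l (Finset.mem_insert_of_mem hl))

theorem pow_dvd_iff_dvd_powRoot {s c : ℕ} (hs : s ≠ 0) (hc : c ≠ 0) (d : ℕ) :
    d ^ s ∣ c ↔ d ∣ powRoot s c := by
  constructor
  · intro h
    exact Finset.dvd_lcm (f := id) (Finset.mem_filter.mpr
      ⟨Nat.mem_divisors.mpr ⟨(dvd_pow_self d hs).trans h, hc⟩, h⟩)
  · intro h
    exact (pow_dvd_pow_of_dvd h s).trans (powRoot_pow_dvd s c)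

theorem powRoot_pow_mul {s c g : ℕ} (hs : s ≠ 0) (hc : c ≠ 0) (hg : g ≠ 0) :
    powRoot s (g ^ s * c) = g * powRoot s c := by
  have hgc : g ^ s * c ≠ 0 := mul_ne_zero (pow_ne_zero s hg) hc
  obtain ⟨r, hr⟩ := (pow_dvd_iff_dvd_powRoot hs hgc g).mp (dvd_mul_right _ _)
  rw [hr]
  congr 1
  refine Nat.dvd_left_iff_eq.mp fun d => ?_
  rw [← pow_dvd_iff_dvd_powRoot hs hc, ← Nat.mul_dvd_mul_iff_left (Nat.pos_of_ne_zero hg),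
    ← hr, ← pow_dvd_iff_dvd_powRoot hs hgc, mul_pow,
    Nat.mul_dvd_mul_iff_left (Nat.pos_of_ne_zero (pow_ne_zero s hg))]

theorem sgcd_natCast {s a b : ℕ} (hs : s ≠ 0) (hb : b ≠ 0) :
    sgcd s (a : ℤ) (b : ℤ) = powRoot s (a.gcd b) ^ s := by
  have hc : a.gcd b ≠ 0 := Nat.gcd_ne_zero_right hb
  have hdvd := powRoot_pow_dvd s (a.gcd b)
  have hpos : 0 < powRoot s (a.gcd b) ^ s := Nat.pos_of_dvd_of_pos hdvd (Nat.pos_of_ne_zero hc)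
  refine IsGreatest.csSup_eq ⟨⟨hpos, ⟨_, rfl⟩, ?_, ?_⟩, ?_⟩
  · exact Int.natCast_dvd_natCast.mpr (hdvd.trans (Nat.gcd_dvd_left a b))
  · exact Int.natCast_dvd_natCast.mpr (hdvd.trans (Nat.gcd_dvd_right a b))
  · rintro _ ⟨-, ⟨l, rfl⟩, ha, hb⟩
    have h := Nat.dvd_gcd (Int.natCast_dvd_natCast.mp ha) (Int.natCast_dvd_natCast.mp hb)
    exact Nat.le_of_dvd hpos
      (pow_dvd_pow_of_dvd ((pow_dvd_iff_dvd_powRoot hs hc l).mp h) s)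

theorem klee_eq_card_filter_nat (s n : ℕ) :
    klee s n = ((Finset.Icc 1 n).filter (fun m : ℕ => sgcd s (m : ℤ) (n : ℤ) = 1)).card := by
  rw [klee, ← Finset.card_image_of_injective _ (Nat.cast_injective (R := ℤ))]
  congr 1
  ext m
  simp only [Finset.bind_def, Finset.pure_def, Finset.mem_filter, Finset.mem_sup,
    Finset.mem_singleton, Finset.mem_image]
  constructor
  · rintro ⟨⟨a, ha, rfl⟩, h⟩
    exact ⟨a, ⟨ha, h⟩, rfl⟩
  · rintro ⟨a, ⟨ha, h⟩, rfl⟩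
    exact ⟨⟨a, ha, rfl⟩, h⟩

theorem card_powRoot_gcd_eq_klee {s g e : ℕ} (hs : s ≠ 0) (hg : g ≠ 0) (he : e ≠ 0) :
    ((Finset.Icc 1 ((g * e) ^ s)).filter
      (fun m => powRoot s (m.gcd ((g * e) ^ s)) = g)).card = klee s (e ^ s) := by
  have hes : e ^ s ≠ 0 := pow_ne_zero s he
  have hgs : 0 < g ^ s := Nat.pos_of_ne_zero (pow_ne_zero s hg)
  have key (m : ℕ) : powRoot s ((g ^ s * m).gcd ((g * e) ^ s)) = g ↔
      sgcd s (m : ℤ) ((e ^ s : ℕ) : ℤ) = 1 := by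
    rw [sgcd_natCast hs hes, mul_pow, Nat.gcd_mul_left,
      powRoot_pow_mul hs (Nat.gcd_ne_zero_right hes) hg, Nat.mul_eq_left hg, Nat.pow_eq_one]
    simp [hs]
  rw [klee_eq_card_filter_nat]
  refine Eq.trans ?_ (Finset.card_image_of_injective _ (mul_right_injective₀ hgs.ne'))
  congr 1
  ext m
  simp only [Finset.mem_filter, Finset.mem_image, Finset.mem_Icc]
  constructor
  · rintro ⟨⟨h1, h2⟩, h3⟩
    have hd : g ^ s ∣ m := by
      have h := powRoot_pow_dvd s (m.gcd ((g * e) ^ s))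
      rw [h3] at h
      exact h.trans (Nat.gcd_dvd_left _ _)
    obtain ⟨m, rfl⟩ := hd
    rw [mul_pow] at h2
    exact ⟨m, ⟨⟨Nat.pos_of_mul_pos_left h1, Nat.le_of_mul_le_mul_left h2 hgs⟩,
      (key m).mp h3⟩, rfl⟩
  · rintro ⟨m, ⟨⟨h1, h2⟩, h3⟩, rfl⟩
    refine ⟨⟨Nat.mul_pos hgs h1, ?_⟩, (key m).mpr h3⟩
    rw [mul_pow]
    exact Nat.mul_le_mul_left _ h2

theorem sum_klee_divisors {s N : ℕ} (hs : s ≠ 0) (hN : N ≠ 0) :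
    ∑ d ∈ N.divisors, klee s (d ^ s) = N ^ s := by
  rw [← Nat.sum_div_divisors N fun d => klee s (d ^ s)]
  calc ∑ d ∈ N.divisors, klee s ((N / d) ^ s)
      = ∑ g ∈ N.divisors, ((Finset.Icc 1 (N ^ s)).filter
          (fun m => powRoot s (m.gcd (N ^ s)) = g)).card := by
        refine Finset.sum_congr rfl fun g hg => ?_
        obtain ⟨e, rfl⟩ := Nat.dvd_of_mem_divisors hg
        obtain ⟨hg0, he0⟩ := mul_ne_zero_iff.mp hN
        rw [Nat.mul_div_cancel_left e (Nat.pos_of_ne_zero hg0),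
          ← card_powRoot_gcd_eq_klee hs hg0 he0]
    _ = (Finset.Icc 1 (N ^ s)).card := by
        refine (Finset.card_eq_sum_card_fiberwise fun m _ => ?_).symm
        refine Nat.mem_divisors.mpr ⟨(Nat.pow_dvd_pow_iff hs).mp ?_, hN⟩
        exact (powRoot_pow_dvd s _).trans (Nat.gcd_dvd_right _ _)
    _ = N ^ s := by simp

theorem sgcd_eq_sum_klee {s n : ℕ} (hs : s ≠ 0) (hn : n ≠ 0) (k : ℕ) :
    sgcd s (k : ℤ) ((n : ℤ) ^ s) =
      ∑ d ∈ n.divisors, if d ^ s ∣ k then klee s (d ^ s) else 0 := by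
  have hns : n ^ s ≠ 0 := pow_ne_zero s hn
  have hc : k.gcd (n ^ s) ≠ 0 := Nat.gcd_ne_zero_right hns
  have hr : powRoot s (k.gcd (n ^ s)) ≠ 0 := fun h => hc <| by
    simpa [h, hs] using powRoot_pow_dvd s (k.gcd (n ^ s))
  rw [← Nat.cast_pow, sgcd_natCast hs hns, ← sum_klee_divisors hs hr, ← Finset.sum_filter]
  refine Finset.sum_congr ?_ fun _ _ => rfl
  ext d
  rw [Finset.mem_filter, Nat.mem_divisors, Nat.mem_divisors, ← pow_dvd_iff_dvd_powRoot hs hc,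
    Nat.dvd_gcd_iff, Nat.pow_dvd_pow_iff hs]
  tauto

theorem sum_Icc_filter_dvd {M : Type*} [AddCommMonoid M] (f : ℕ → M) {a N : ℕ} (ha : 0 < a) :
    ∑ k ∈ (Finset.Icc 1 N).filter (fun k => a ∣ k), f k =
      ∑ j ∈ Finset.Icc 1 (N / a), f (a * j) := by
  rw [← Finset.sum_image (f := f) (g := fun j => a * j)
    (mul_right_injective₀ ha.ne').injOn]
  refine Finset.sum_congr ?_ fun _ _ => rfl
  ext k
  simp only [Finset.mem_filter, Finset.mem_image, Finset.mem_Icc]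
  constructor
  · rintro ⟨⟨h1, h2⟩, j, rfl⟩
    exact ⟨j, ⟨Nat.pos_of_mul_pos_left h1, (Nat.le_div_iff_mul_le ha).mpr (by linarith)⟩, rfl⟩
  · rintro ⟨j, ⟨h1, h2⟩, rfl⟩
    refine ⟨⟨Nat.mul_pos ha h1, ?_⟩, dvd_mul_right a j⟩
    rw [mul_comm]
    exact (Nat.le_div_iff_mul_le ha).mp h2

theorem filter_pow_dvd_divisors_pow {s n : ℕ} (hs : s ≠ 0) (hn : n ≠ 0) :
    (n ^ s).divisors.filter (fun d => d ^ s ∣ n ^ s) = n.divisors := by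
  ext d
  rw [Finset.mem_filter, Nat.mem_divisors, Nat.mem_divisors, Nat.pow_dvd_pow_iff hs]
  exact ⟨fun h => ⟨h.2, hn⟩, fun h => ⟨⟨h.1.trans (dvd_pow_self n hs), pow_ne_zero s hn⟩, h.1⟩⟩

theorem weighted_sgcd_sum (ψ : ℕ × ℕ → ℂ) (n s : ℕ) (hn : 0 < n) (hs : 0 < s) :
    ∑ k ∈ Finset.Icc 1 (n ^ s), ψ (k, n ^ s) * (sgcd s (k : ℤ) ((n : ℤ) ^ s) : ℂ)
    = ∑ d ∈ (n ^ s).divisors.filter (fun d => d ^ s ∣ n ^ s),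
        (klee s (d ^ s) : ℂ) * ∑ j ∈ Finset.Icc 1 (n ^ s / d ^ s), ψ (d ^ s * j, n ^ s) := by
  rw [filter_pow_dvd_divisors_pow hs.ne' hn.ne']
  simp_rw [sgcd_eq_sum_klee hs.ne' hn.ne', Nat.cast_sum, Finset.mul_sum]
  rw [Finset.sum_comm]
  refine Finset.sum_congr rfl fun d hd => ?_
  have hd0 : 0 < d ^ s := Nat.pow_pos (Nat.pos_of_mem_divisors hd)
  rw [← Finset.mul_sum, ← sum_Icc_filter_dvd (fun k => ψ (k, n ^ s)) hd0, Finset.mul_sum,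
    Finset.sum_filter]
  refine Finset.sum_congr rfl fun k _ => ?_
  split_ifs <;> simp [mul_comm]
end

section
/- For all positive integers n and s, Φ_s(n) = n · Π_{p prime, p^s | n} (1 − 1/p^s), the product being over the primes p whose s-th power divides n. -/
open scoped Classical

theorem sgcd_eq_one_iff_s6 {s a b : ℕ} (hs : 0 < s) (hb : 0 < b) :
    sgcd s (a : ℤ) (b : ℤ) = 1 ↔ ∀ p : ℕ, p.Prime → p ^ s ∣ b → ¬ p ^ s ∣ a := by
  unfold sgcd
  simp only [Int.natCast_dvd_natCast]
  constructor
  · intro h p hp hpb hpa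
    have hle : p ^ s ≤ 1 := h ▸ le_csSup
      ⟨b, fun m hm => Nat.le_of_dvd hb hm.2.2.2⟩ ⟨pow_pos hp.pos s, ⟨p, rfl⟩, hpa, hpb⟩
    exact absurd hle (Nat.one_lt_pow hs.ne' hp.one_lt).not_ge
  · intro h
    have hset : {m : ℕ | 0 < m ∧ (∃ l : ℕ, m = l ^ s) ∧ m ∣ a ∧ m ∣ b} = {1} := by
      ext m
      simp only [Set.mem_ofPred_eq, Set.mem_singleton_iff]
      constructor
      · rintro ⟨-, ⟨l, rfl⟩, ha, hb⟩
        by_contra hl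
        have hl1 : l ≠ 1 := fun h1 => hl (by simp [h1])
        obtain ⟨p, hp, hpl⟩ := Nat.exists_prime_and_dvd hl1
        exact h p hp ((pow_dvd_pow_of_dvd hpl s).trans hb) ((pow_dvd_pow_of_dvd hpl s).trans ha)
      · rintro rfl
        exact ⟨one_pos, ⟨1, (one_pow s).symm⟩, one_dvd a, one_dvd b⟩
    rw [hset, csSup_singleton]

theorem card_filter_forall_not_dvd {ι : Type*} (S : Finset ι) (f : ι → ℕ)
    (hf : ∀ i ∈ S, 0 < f i) (hco : (S : Set ι).Pairwise fun i j => (f i).Coprime (f j))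
    (N : ℕ) (hN : ∏ i ∈ S, f i ∣ N) :
    (((Finset.Icc 1 N).filter fun m => ∀ i ∈ S, ¬ f i ∣ m).card : ℚ)
      = N * ∏ i ∈ S, (1 - 1 / (f i : ℚ)) := by
  induction S using Finset.induction_on generalizing N with
  | empty => simp
  | insert a S ha ih =>
    have hpos : 0 < f a := hf a (Finset.mem_insert_self a S)
    have hf' : ∀ i ∈ S, 0 < f i := fun i hi => hf i (Finset.mem_insert_of_mem hi)
    have hco' : (S : Set ι).Pairwise fun i j => (f i).Coprime (f j) :=
      hco.mono (by simp)
    have hcop : ∀ i ∈ S, (f i).Coprime (f a) := fun i hi =>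
      hco (by simp [hi]) (by simp) (fun h => ha (h ▸ hi))
    rw [Finset.prod_insert ha] at hN
    obtain ⟨k, rfl⟩ := (dvd_mul_right (f a) _).trans hN
    have hk : ∏ i ∈ S, f i ∣ k := Nat.dvd_of_mul_dvd_mul_left hpos hN
    have h1 := ih hf' hco' (f a * k) (hk.mul_left _)
    have h2 := ih hf' hco' k hk
    have hmul : (((Finset.Icc 1 (f a * k)).filter fun m => ∀ i ∈ S, ¬ f i ∣ m).filter
        fun m => f a ∣ m) =
        ((Finset.Icc 1 k).filter fun m => ∀ i ∈ S, ¬ f i ∣ m).image (f a * ·) := by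
      ext m
      simp only [Finset.mem_filter, Finset.mem_Icc, Finset.mem_image]
      constructor
      · rintro ⟨⟨⟨hm1, hm2⟩, hm⟩, c, rfl⟩
        exact ⟨c, ⟨⟨Nat.pos_of_mul_pos_left hm1, Nat.le_of_mul_le_mul_left hm2 hpos⟩,
          fun i hi hc => hm i hi (hc.mul_left _)⟩, rfl⟩
      · rintro ⟨c, ⟨⟨hc1, hc2⟩, hc⟩, rfl⟩
        exact ⟨⟨⟨Nat.mul_pos hpos hc1, Nat.mul_le_mul_left _ hc2⟩,
          fun i hi h => hc i hi ((hcop i hi).dvd_of_dvd_mul_left h)⟩, dvd_mul_right _ _⟩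
    have hnot : ((Finset.Icc 1 (f a * k)).filter fun m => ∀ i ∈ insert a S, ¬ f i ∣ m) =
        ((Finset.Icc 1 (f a * k)).filter fun m => ∀ i ∈ S, ¬ f i ∣ m).filter
          fun m => ¬ f a ∣ m := by
      ext m
      simp only [Finset.mem_filter, Finset.forall_mem_insert]
      tauto
    have hsplit := Finset.card_filter_add_card_filter_not
      (s := (Finset.Icc 1 (f a * k)).filter fun m => ∀ i ∈ S, ¬ f i ∣ m) (fun m => f a ∣ m)
    rw [hmul, ← hnot, Finset.card_image_of_injective _ (mul_right_injective₀ hpos.ne')]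
      at hsplit
    have hsplit' := congrArg (Nat.cast : ℕ → ℚ) hsplit
    rw [Nat.cast_add, h1, h2] at hsplit'
    rw [eq_sub_of_add_eq' hsplit', Finset.prod_insert ha]
    have hq : (f a : ℚ) ≠ 0 := by exact_mod_cast hpos.ne'
    push_cast
    field_simp

theorem klee_product_formula (n s : ℕ) (hn : 0 < n) (hs : 0 < s) :
    (klee s n : ℚ)
    = (n : ℚ) * ∏ p ∈ n.primeFactors.filter (fun p => p ^ s ∣ n), (1 - 1 / (p : ℚ) ^ s) := by
  set S := n.primeFactors.filter (fun p => p ^ s ∣ n) with hS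
  have hmem : ∀ p, p ∈ S ↔ p.Prime ∧ p ^ s ∣ n := fun p => by
    rw [hS, Finset.mem_filter, Nat.mem_primeFactors]
    exact ⟨fun h => ⟨h.1.1, h.2⟩, fun h => ⟨⟨h.1, (dvd_pow_self p hs.ne').trans h.2, hn.ne'⟩, h.2⟩⟩
  have hco : (S : Set ℕ).Pairwise fun p q => (p ^ s).Coprime (q ^ s) := fun p hp q hq hpq =>
    Nat.Coprime.pow s s ((Nat.coprime_primes ((hmem p).1 hp).1 ((hmem q).1 hq).1).2 hpq)
  have hdvd : ∏ p ∈ S, p ^ s ∣ n :=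
    Finset.prod_dvd_of_isRelPrime (fun p hp q hq hpq => Nat.coprime_iff_isRelPrime.1 (hco hp hq hpq))
      fun p hp => ((hmem p).1 hp).2
  have hcard := card_filter_forall_not_dvd S (· ^ s)
    (fun p hp => pow_pos ((hmem p).1 hp).1.pos s) hco n hdvd
  simp only [Nat.cast_pow] at hcard
  have hklee : klee s n =
      ((Finset.Icc 1 n).filter fun m : ℕ => sgcd s (m : ℤ) (n : ℤ) = 1).card := by
    rw [klee, ← Finset.card_image_of_injective _ (Nat.cast_injective (R := ℤ))]
    congr 1
    ext x
    simp only [Finset.bind_def, Finset.pure_def, Finset.sup_singleton_apply, Finset.mem_filter,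
      Finset.mem_image]
    constructor
    · rintro ⟨⟨m, hm, rfl⟩, h⟩
      exact ⟨m, ⟨hm, h⟩, rfl⟩
    · rintro ⟨m, ⟨hm, h⟩, rfl⟩
      exact ⟨⟨m, hm, rfl⟩, h⟩
  rw [← hcard, hklee]
  refine congrArg (fun t : Finset ℕ => (t.card : ℚ)) (Finset.ext fun m => ?_)
  simp only [Finset.mem_filter, sgcd_eq_one_iff_s6 hs hn, hmem, and_imp]
end
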